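/- Let K be a totally real number field of degree n over ℚ with discriminant Δ_K. Then for every totally positive a ∈ K, μ(a) ≤ (2/π) · Γ(2 + n/2)^{2/n} · |Δ_K|^{1/n} · Nm_{K/ℚ}(a)^{1/n}. -/

import Mathlib

open NumberField Real

/-- An element of a number field is *totally positive* if it is positive under
every real embedding. -/
def TotPos {K : Type*} [Field K] (a : K) : Prop := ∀ φ : K →+* ℝ, 0 < φ a

/-- The value of the trace form `Tr_{K/ℚ}(a x²)` at an algebraic integer `x`. -/
noncomputable def trForm {K : Type*} [Field K] [NumberField K] (a : K) (x : 𝓞 K) : ℚ :=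
  Algebra.trace ℚ K (a * (x : K) ^ 2)

/-- `μ(a)`: the minimum of `Tr_{K/ℚ}(a x²)` over nonzero `x ∈ 𝓞 K`. -/
noncomputable def muMin {K : Type*} [Field K] [NumberField K] (a : K) : ℝ :=
  sInf {t : ℝ | ∃ x : 𝓞 K, x ≠ 0 ∧ (trForm a x : ℝ) = t}

/-- `M(a)`: the set of algebraic integers attaining `μ(a)`. -/
def MinVecs {K : Type*} [Field K] [NumberField K] (a : K) : Set (𝓞 K) :=
  {x | ((trForm a x : ℚ) : ℝ) = muMin a}

/-- A totally positive `a` is *perfect* if it is the unique totally positive element `b`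
with `Tr(b x²) = μ(a)` for all `x ∈ M(a)`. -/
def IsPerfectForm {K : Type*} [Field K] [NumberField K] (a : K) : Prop :=
  TotPos a ∧ ∀ b : K, TotPos b → (∀ x ∈ MinVecs a, ((trForm b x : ℚ) : ℝ) = muMin a) → b = a

/-- `a ~ a'` : equivalence by squares of units. -/
def UnitEquiv {K : Type*} [Field K] [NumberField K] (a a' : K) : Prop :=
  ∃ u : (𝓞 K)ˣ, a' = a * ((u : 𝓞 K) : K) ^ 2

/-- Homothety: `a` and `b` are homothetic if `λ a ~ b` for some positive rational `λ`. -/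
def Homothetic {K : Type*} [Field K] [NumberField K] (a b : K) : Prop :=
  ∃ q : ℚ, 0 < q ∧ UnitEquiv ((q : K) * a) b

/-- The number of homothety classes of perfect unary forms of `K`. -/
noncomputable def numClasses (K : Type*) [Field K] [NumberField K] : ℕ :=
  Nat.card (Quot (fun a b : {a : K // IsPerfectForm a} => Homothetic (a : K) (b : K)))

/-- `K` is `A`-reducible if minimal vectors of totally positive elements have norm at most `A`. -/
def IsAReducible (K : Type*) [Field K] [NumberField K] (A : ℝ) : Prop :=
  ∀ a : K, TotPos a → ∀ x ∈ MinVecs a, |(Algebra.norm ℚ (x : K) : ℝ)| ≤ A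

/-- `K` is totally real if every infinite place is real. -/
def TotallyReal (K : Type*) [Field K] [NumberField K] : Prop :=
  ∀ v : NumberField.InfinitePlace K, v.IsReal

/-- Blichfeldt's weight: the paraboloid `1 - 2‖x‖² / m`, truncated below at `0`. -/
noncomputable def blichfeldtWeight {E : Type*} [Norm E] (m : ℝ) (x : E) : ℝ :=
  max 0 (1 - 2 / m * ‖x‖ ^ 2)

theorem blichfeldtWeight_nonneg {E : Type*} [Norm E] (m : ℝ) (x : E) : 0 ≤ blichfeldtWeight m x :=
  le_max_left _ _

/-- The sum of squared mutual distances, in terms of norms and the norm of the sum. -/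
theorem sum_sum_norm_sub_sq {ι E : Type*} [NormedAddCommGroup E] [InnerProductSpace ℝ E]
    (s : Finset ι) (y : ι → E) :
    ∑ i ∈ s, ∑ j ∈ s, ‖y i - y j‖ ^ 2 =
      2 * (s.card * ∑ i ∈ s, ‖y i‖ ^ 2) - 2 * ‖∑ i ∈ s, y i‖ ^ 2 := by
  simp_rw [norm_sub_sq_real, Finset.sum_add_distrib, Finset.sum_sub_distrib, ← Finset.mul_sum,
    ← inner_sum, ← sum_inner, real_inner_self_eq_norm_sq, Finset.sum_const, nsmul_eq_mul,
    ← Finset.mul_sum]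
  ring

/-- Blichfeldt's inequality: around vectors at mutual distance at least `√m` the weights sum to
at most `1`. -/
theorem sum_blichfeldtWeight_le_one {ι E : Type*} [NormedAddCommGroup E] [InnerProductSpace ℝ E]
    {m : ℝ} (hm : 0 < m) (s : Finset ι) (y : ι → E)
    (hy : ∀ i ∈ s, ∀ j ∈ s, i ≠ j → m ≤ ‖y i - y j‖ ^ 2) :
    ∑ i ∈ s, blichfeldtWeight m (y i) ≤ 1 := by
  classical
  set t := s.filter fun i ↦ 0 < 1 - 2 / m * ‖y i‖ ^ 2
  have hsum : ∑ i ∈ s, blichfeldtWeight m (y i) = ∑ i ∈ t, (1 - 2 / m * ‖y i‖ ^ 2) := by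
    rw [Finset.sum_filter]
    refine Finset.sum_congr rfl fun i _ ↦ ?_
    split_ifs with h
    · exact max_eq_right h.le
    · exact max_eq_left (not_lt.mp h)
  rw [hsum]
  rcases t.eq_empty_or_nonempty with ht | ht
  · simp [ht]
  have hk : (0 : ℝ) < t.card := by exact_mod_cast ht.card_pos
  have hlow : (t.card : ℝ) * ((t.card - 1) * m) ≤ ∑ i ∈ t, ∑ j ∈ t, ‖y i - y j‖ ^ 2 := by
    rw [← nsmul_eq_mul, ← Finset.sum_const]
    refine Finset.sum_le_sum fun i hi ↦ ?_
    rw [← Finset.sum_erase_add t _ hi, sub_self, norm_zero, ← Finset.cast_card_erase_of_mem hi,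
      ← nsmul_eq_mul, ← Finset.sum_const]
    simp only [ne_eq, OfNat.ofNat_ne_zero, not_false_eq_true, zero_pow, add_zero]
    refine Finset.sum_le_sum fun j hj ↦ ?_
    have hj' := Finset.mem_erase.mp hj
    exact hy i (Finset.mem_filter.mp hi).1 j (Finset.mem_filter.mp hj'.2).1 hj'.1.symm
  rw [sum_sum_norm_sub_sq] at hlow
  have hlow' : (t.card - 1) * m ≤ 2 * ∑ i ∈ t, ‖y i‖ ^ 2 := by
    refine le_of_mul_le_mul_left ?_ hk
    nlinarith [sq_nonneg ‖∑ i ∈ t, y i‖]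
  rw [Finset.sum_sub_distrib, ← Finset.mul_sum, Finset.sum_const, nsmul_eq_mul, mul_one,
    div_mul_eq_mul_div, sub_le_comm, le_div_iff₀ hm]
  exact hlow'

open MeasureTheory Module in
theorem lintegral_blichfeldtWeight_le {E : Type*} [NormedAddCommGroup E] [InnerProductSpace ℝ E]
    [MeasurableSpace E] [BorelSpace E] {μ : Measure E} [μ.IsAddLeftInvariant]
    (L : AddSubgroup E) [Countable L] {F : Set E} (hF : IsAddFundamentalDomain L F μ)
    {m : ℝ} (hm : 0 < m) (hL : ∀ v ∈ L, v ≠ 0 → m ≤ ‖v‖ ^ 2) :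
    ∫⁻ x, ENNReal.ofReal (blichfeldtWeight m x) ∂μ ≤ μ F := by
  have hmeas : Measurable fun x : E ↦ ENNReal.ofReal (blichfeldtWeight m x) := by
    unfold blichfeldtWeight
    fun_prop
  rw [hF.lintegral_eq_tsum'', ← lintegral_tsum (f := fun (v : L) (x : E) ↦
    ENNReal.ofReal (blichfeldtWeight m (v +ᵥ x)))
    fun v ↦ (hmeas.comp (measurable_const_vadd v)).aemeasurable]
  calc ∫⁻ x in F, ∑' v : L, ENNReal.ofReal (blichfeldtWeight m (v +ᵥ x)) ∂μ
      ≤ ∫⁻ _ in F, 1 ∂μ := by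
        refine lintegral_mono fun x ↦ ?_
        rw [ENNReal.tsum_eq_iSup_sum]
        refine iSup_le fun s ↦ ?_
        rw [← ENNReal.ofReal_sum_of_nonneg fun _ _ ↦ blichfeldtWeight_nonneg _ _,
          ENNReal.ofReal_le_one]
        refine sum_blichfeldtWeight_le_one hm s _ fun i _ j _ hij ↦ ?_
        have : (i +ᵥ x : E) - (j +ᵥ x) = ((i - j : L) : E) := by
          simp [AddSubgroup.vadd_def]
        rw [this]
        exact hL _ (i - j).2 (by simpa [sub_eq_zero] using hij)
    _ = μ F := by simp

open MeasureTheory Module in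
theorem integral_blichfeldtWeight {E : Type*} [NormedAddCommGroup E] [InnerProductSpace ℝ E]
    [FiniteDimensional ℝ E] [Nontrivial E] [MeasurableSpace E] [BorelSpace E]
    (μ : Measure E) [μ.IsAddHaarMeasure] {m : ℝ} (hm : 0 < m) :
    ∫ x : E, blichfeldtWeight m x ∂μ =
      2 / (finrank ℝ E + 2) * √(m / 2) ^ finrank ℝ E * μ.real (Metric.ball 0 1) := by
  set n := finrank ℝ E with hn
  have hn0 : 0 < n := finrank_pos
  set R := √(m / 2)
  have hR : 0 < R := by positivity
  have hR2 : R ^ 2 = m / 2 := Real.sq_sqrt (by positivity)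
  have hmR : 2 / m = (R ^ 2)⁻¹ := by rw [hR2]; field_simp
  have key : ∫ y in Set.Ioi (0 : ℝ), y ^ (n - 1) • max 0 (1 - 2 / m * y ^ 2) =
      2 / (n * (n + 2)) * R ^ n := by
    rw [← Set.Ioc_union_Ioi_eq_Ioi hR.le]
    rw [setIntegral_eq_of_subset_of_forall_sdiff_eq_zero (s := Set.Ioc 0 R)
      (measurableSet_Ioc.union measurableSet_Ioi) Set.subset_union_left]
    · have h1 : ∫ y in Set.Ioc 0 R, y ^ (n - 1) • max 0 (1 - 2 / m * y ^ 2) =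
          ∫ y in Set.Ioc 0 R, (y ^ (n - 1) - 2 / m * y ^ (n + 1)) := by
        refine setIntegral_congr_fun measurableSet_Ioc fun y hy ↦ ?_
        have : 2 / m * y ^ 2 ≤ 1 := by
          rw [hmR, inv_mul_le_one₀ (by positivity)]
          exact pow_le_pow_left₀ hy.1.le hy.2 2
        simp only [smul_eq_mul]
        rw [max_eq_right (by linarith), show n + 1 = n - 1 + 2 by omega, pow_add]
        ring
      rw [h1, ← intervalIntegral.integral_of_le hR.le, intervalIntegral.integral_sub
        ((by fun_prop : Continuous _).intervalIntegrable _ _)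
        ((by fun_prop : Continuous _).intervalIntegrable _ _), intervalIntegral.integral_const_mul,
        integral_pow, integral_pow, hmR]
      obtain ⟨k, hk⟩ := Nat.exists_eq_add_of_le' hn0
      rw [hk]
      simp only [Nat.add_sub_cancel]
      push_cast
      field_simp
      ring
    · rintro y ⟨hy, hy'⟩
      have hy1 : R < y := by
        rcases hy with h | h
        · exact absurd h hy'
        · exact h
      rw [max_eq_left, smul_zero]
      rw [sub_nonpos, hmR, ← div_eq_inv_mul, one_le_div (by positivity)]
      exact pow_le_pow_left₀ hR.le hy1.le 2
  have := integral_fun_norm_addHaar μ (fun y ↦ max 0 (1 - 2 / m * y ^ 2))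
  rw [← hn] at this
  unfold blichfeldtWeight
  rw [this, key, nsmul_eq_mul, smul_eq_mul]
  have : (n : ℝ) ≠ 0 := by positivity
  field_simp

open MeasureTheory Module in
theorem integrable_blichfeldtWeight {E : Type*} [NormedAddCommGroup E] [InnerProductSpace ℝ E]
    [FiniteDimensional ℝ E] [MeasurableSpace E] [BorelSpace E]
    (μ : Measure E) [μ.IsAddHaarMeasure] {m : ℝ} (hm : 0 < m) :
    Integrable (blichfeldtWeight m : E → ℝ) μ := by
  refine Continuous.integrable_of_hasCompactSupport (by unfold blichfeldtWeight; fun_prop) ?_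
  refine HasCompactSupport.intro (isCompact_closedBall (0 : E) √(m / 2)) fun x hx ↦ ?_
  rw [mem_closedBall_zero_iff, not_le, Real.sqrt_lt (by positivity) (norm_nonneg x)] at hx
  refine max_eq_left ?_
  rw [sub_nonpos, div_mul_eq_mul_div, one_le_div hm]
  linarith

open MeasureTheory Module in
theorem volume_fundamentalDomain_eq_sqrt_det_gram {ι E : Type*} [Fintype ι]
    [DecidableEq ι] [NormedAddCommGroup E] [InnerProductSpace ℝ E] [FiniteDimensional ℝ E]
    [MeasurableSpace E] [BorelSpace E] (b : Basis ι ℝ E) :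
    volume (ZSpan.fundamentalDomain b) = ENNReal.ofReal √(Matrix.gram ℝ b).det := by
  have e : Fin (finrank ℝ E) ≃ ι := Fintype.equivOfCardEq (by
    rw [Fintype.card_fin, finrank_eq_card_basis b])
  let o : OrthonormalBasis ι ℝ E := (stdOrthonormalBasis ℝ E).reindex e
  have hgram : Matrix.gram ℝ b = (o.toBasis.toMatrix b).transpose * o.toBasis.toMatrix b := by
    ext i j
    simp [Matrix.gram_apply, Matrix.mul_apply, Basis.toMatrix_apply,
      ← o.sum_inner_mul_inner (b i) (b j), o.repr_apply_apply, real_inner_comm]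
  rw [ZSpan.measure_fundamentalDomain b volume o.toBasis, hgram, Matrix.det_mul,
    Matrix.det_transpose, Real.sqrt_mul_self_eq_abs, ← Basis.det_apply,
    measure_congr (ZSpan.fundamentalDomain_ae_parallelepiped _ _), o.coe_toBasis,
    o.volume_parallelepiped, mul_one]

open MeasureTheory Module in
/-- **Blichfeldt's bound** for the minimum of a lattice in terms of the determinant of a Gram
matrix. -/
theorem le_blichfeldt_bound {ι E : Type*} [Fintype ι] [DecidableEq ι] [Nonempty ι]
    [NormedAddCommGroup E] [InnerProductSpace ℝ E] [FiniteDimensional ℝ E]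
    (v : ι → E) (hcard : finrank ℝ E = Fintype.card ι) (hdet : (Matrix.gram ℝ v).det ≠ 0)
    {m : ℝ} (hm : 0 < m)
    (hv : ∀ x ∈ Submodule.span ℤ (Set.range v), x ≠ 0 → m ≤ ‖x‖ ^ 2) :
    m ≤ 2 / π * Gamma (2 + (Fintype.card ι : ℝ) / 2) ^ ((2 : ℝ) / Fintype.card ι) *
      (Matrix.gram ℝ v).det ^ ((1 : ℝ) / Fintype.card ι) := by
  let : MeasurableSpace E := borel E
  have : BorelSpace E := ⟨rfl⟩
  have : Nontrivial E := nontrivial_of_finrank_pos (R := ℝ) (hcard ▸ Fintype.card_pos)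
  have hli : LinearIndependent ℝ v := Matrix.linearIndependent_of_det_gram_ne_zero hdet
  let b : Basis ι ℝ E := basisOfLinearIndependentOfCardEqFinrank hli hcard.symm
  have hb : ⇑b = v := coe_basisOfLinearIndependentOfCardEqFinrank _ _
  set n := Fintype.card ι
  have hn : 0 < n := Fintype.card_pos
  set D := (Matrix.gram ℝ v).det
  have hD : 0 ≤ D := (Matrix.posSemidef_gram ℝ v).det_nonneg
  have : Countable (Submodule.span ℤ (Set.range b)).toAddSubgroup :=
    inferInstanceAs (Countable (Submodule.span ℤ (Set.range b)))
  have hle := lintegral_blichfeldtWeight_le (Submodule.span ℤ (Set.range b)).toAddSubgroup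
    (ZSpan.isAddFundamentalDomain' b volume) hm (by rw [hb]; exact hv)
  rw [volume_fundamentalDomain_eq_sqrt_det_gram, hb, ← ofReal_integral_eq_lintegral_ofReal
    (integrable_blichfeldtWeight volume hm) (.of_forall fun x ↦ blichfeldtWeight_nonneg _ _),
    ENNReal.ofReal_le_ofReal_iff (Real.sqrt_nonneg _), integral_blichfeldtWeight volume hm,
    measureReal_def, InnerProductSpace.volume_ball, hcard] at hle
  have hΓ : 0 < Gamma (2 + (n : ℝ) / 2) := Gamma_pos_of_pos (by positivity)
  have hΓ' : 0 < Gamma ((n : ℝ) / 2 + 1) := Gamma_pos_of_pos (by positivity)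
  have hrec : Gamma (2 + (n : ℝ) / 2) = (n / 2 + 1) * Gamma ((n : ℝ) / 2 + 1) := by
    rw [← Gamma_add_one (by positivity)]
    ring_nf
  rw [ENNReal.toReal_mul, ENNReal.ofReal_one, one_pow, ENNReal.toReal_one, one_mul,
    ENNReal.toReal_ofReal (by positivity)] at hle
  have hle' : √(m / 2 * π) ^ n ≤ Gamma (2 + (n : ℝ) / 2) * √D := by
    rw [Real.sqrt_mul (by positivity), mul_pow, hrec]
    calc √(m / 2) ^ n * √π ^ n
        = ((n / 2 + 1) * Gamma ((n : ℝ) / 2 + 1)) * (2 / (n + 2) * √(m / 2) ^ n *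
          (√π ^ n / Gamma ((n : ℝ) / 2 + 1))) := by field_simp
      _ ≤ _ := by gcongr
  have hroot := Real.rpow_le_rpow (by positivity) hle' (by positivity : (0 : ℝ) ≤ 2 / n)
  rw [← Real.rpow_natCast, ← Real.rpow_mul (by positivity), mul_div_cancel₀ _ (by positivity),
    Real.rpow_two, Real.sq_sqrt (by positivity), Real.mul_rpow hΓ.le (by positivity),
    Real.sqrt_eq_rpow, ← Real.rpow_mul hD, show (1 / 2 : ℝ) * (2 / n) = 1 / n by ring] at hroot
  rw [mul_assoc, div_mul_eq_mul_div, le_div_iff₀ pi_pos]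
  linarith

/-- In a totally real field the real embeddings account for all complex embeddings. -/
theorem TotallyReal.bijective_ofRealHom_comp {K : Type*} [Field K] [NumberField K]
    (h : TotallyReal K) :
    Function.Bijective fun φ : K →+* ℝ ↦ Complex.ofRealHom.comp φ := by
  refine ⟨fun φ ψ hφψ ↦ RingHom.ext fun x ↦ Complex.ofReal_injective (RingHom.congr_fun hφψ x),
    fun φ ↦ ?_⟩
  have hφ := InfinitePlace.isReal_mk_iff.mp (h (InfinitePlace.mk φ))
  exact ⟨hφ.embedding, RingHom.ext fun x ↦ hφ.coe_embedding_apply x⟩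

theorem finite_ringHom_real (K : Type*) [Field K] [NumberField K] : Finite (K →+* ℝ) :=
  Finite.of_injective (fun φ : K →+* ℝ ↦ Complex.ofRealHom.comp φ) fun _ _ h ↦
    RingHom.ext fun x ↦ Complex.ofReal_injective (RingHom.congr_fun h x)

theorem TotallyReal.card_ringHom_real {K : Type*} [Field K] [NumberField K]
    (h : TotallyReal K) [Fintype (K →+* ℝ)] :
    Fintype.card (K →+* ℝ) = Module.finrank ℚ K := by
  rw [← Embeddings.card K ℂ]
  exact Fintype.card_of_bijective h.bijective_ofRealHom_comp

theorem TotallyReal.trace_eq_sum {K : Type*} [Field K] [NumberField K]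
    (h : TotallyReal K) [Fintype (K →+* ℝ)] (x : K) :
    (Algebra.trace ℚ K x : ℝ) = ∑ φ : K →+* ℝ, φ x := by
  apply Complex.ofReal_injective
  have := trace_eq_sum_embeddings (K := ℚ) (L := K) ℂ (x := x)
  rw [Complex.ofReal_ratCast, ← eq_ratCast (algebraMap ℚ ℂ), this, Complex.ofReal_sum,
    ← (RingHom.equivRatAlgHom (R := K) (S := ℂ)).sum_comp]
  exact (h.bijective_ofRealHom_comp.sum_comp fun σ : K →+* ℂ ↦ σ x).symm

theorem TotallyReal.norm_eq_prod {K : Type*} [Field K] [NumberField K]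
    (h : TotallyReal K) [Fintype (K →+* ℝ)] (x : K) :
    (Algebra.norm ℚ x : ℝ) = ∏ φ : K →+* ℝ, φ x := by
  apply Complex.ofReal_injective
  have := Algebra.norm_eq_prod_embeddings ℚ (L := K) ℂ x
  rw [Complex.ofReal_ratCast, ← eq_ratCast (algebraMap ℚ ℂ), this, Complex.ofReal_prod,
    ← (RingHom.equivRatAlgHom (R := K) (S := ℂ)).prod_comp]
  exact (h.bijective_ofRealHom_comp.prod_comp fun σ : K →+* ℂ ↦ σ x).symm

/-- The Minkowski-type embedding `x ↦ (√φ(a) φ(x))_φ` over the real embeddings `φ`. -/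
noncomputable def twistedEmbedding {K : Type*} [Field K] (a : K) :
    K →+ EuclideanSpace ℝ (K →+* ℝ) where
  toFun x := WithLp.toLp 2 fun φ ↦ √(φ a) * φ x
  map_zero' := by ext; simp
  map_add' x y := by ext; simp [mul_add]

theorem inner_twistedEmbedding {K : Type*} [Field K] [NumberField K] (h : TotallyReal K)
    [Fintype (K →+* ℝ)] {a : K} (ha : TotPos a) (x y : K) :
    inner ℝ (twistedEmbedding a x) (twistedEmbedding a y) =
      (Algebra.trace ℚ K (a * x * y) : ℝ) := by
  rw [h.trace_eq_sum, PiLp.inner_apply]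
  refine Finset.sum_congr rfl fun φ _ ↦ ?_
  simp only [twistedEmbedding, AddMonoidHom.coe_mk, ZeroHom.coe_mk, RCLike.inner_apply, conj_trivial,
    map_mul]
  linear_combination (φ x * φ y) * Real.mul_self_sqrt (ha φ).le

theorem norm_twistedEmbedding_sq {K : Type*} [Field K] [NumberField K] (h : TotallyReal K)
    [Fintype (K →+* ℝ)] {a : K} (ha : TotPos a) (x : K) :
    ‖twistedEmbedding a x‖ ^ 2 = (Algebra.trace ℚ K (a * x ^ 2) : ℝ) := by
  rw [← real_inner_self_eq_norm_sq, inner_twistedEmbedding h ha, mul_assoc, sq]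

theorem det_trace_mul_mul {K L ι : Type*} [Field K] [Field L] [Algebra K L] [Fintype ι]
    [DecidableEq ι] (b : Module.Basis ι K L) (a : L) :
    (Matrix.of fun i j ↦ Algebra.trace K L (a * b i * b j)).det =
      Algebra.norm K a * Algebra.discr K b := by
  have hmul : (Matrix.of fun i j ↦ Algebra.trace K L (a * b i * b j)) =
      (Algebra.leftMulMatrix b a).transpose * Algebra.traceMatrix K b := by
    ext i j
    simp only [Matrix.of_apply, Matrix.mul_apply, Matrix.transpose_apply,
      Algebra.leftMulMatrix_eq_repr_mul, Algebra.traceMatrix_apply, Algebra.traceForm_apply]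
    conv_lhs => rw [← b.sum_repr (a * b i)]
    simp only [Finset.sum_mul, map_sum, smul_mul_assoc, map_smul, smul_eq_mul]
  rw [hmul, Matrix.det_mul, Matrix.det_transpose, ← Algebra.norm_eq_matrix_det, Algebra.discr_def]

theorem det_gram_twistedEmbedding_integralBasis {K : Type*} [Field K] [NumberField K]
    (h : TotallyReal K) [Fintype (K →+* ℝ)]
    [DecidableEq (Module.Free.ChooseBasisIndex ℤ (𝓞 K))] {a : K} (ha : TotPos a) :
    (Matrix.gram ℝ fun i ↦ twistedEmbedding a (integralBasis K i)).det =
      (Algebra.norm ℚ a : ℝ) * (discr K : ℝ) := by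
  have hmap : (Matrix.gram ℝ fun i ↦ twistedEmbedding a (integralBasis K i)) =
      (algebraMap ℚ ℝ).mapMatrix (Matrix.of fun i j ↦
        Algebra.trace ℚ K (a * integralBasis K i * integralBasis K j)) := by
    ext i j
    simp only [Matrix.gram_apply, inner_twistedEmbedding h ha]
    rfl
  have hdiscr : (Algebra.discr ℚ (integralBasis K) : ℚ) = discr K := by
    convert (coe_discr K).symm
  rw [hmap, ← RingHom.map_det, det_trace_mul_mul, map_mul, hdiscr]
  simp

theorem TotPos.trForm_nonneg {K : Type*} [Field K] [NumberField K] (h : TotallyReal K)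
    {a : K} (ha : TotPos a) (x : 𝓞 K) : (0 : ℝ) ≤ trForm a x := by
  have := @Fintype.ofFinite _ (finite_ringHom_real K)
  rw [trForm, ← norm_twistedEmbedding_sq h ha]
  positivity

theorem TotPos.muMin_le {K : Type*} [Field K] [NumberField K] (h : TotallyReal K)
    {a : K} (ha : TotPos a) {x : 𝓞 K} (hx : x ≠ 0) : muMin a ≤ trForm a x := by
  refine csInf_le ⟨0, ?_⟩ ⟨x, hx, rfl⟩
  rintro _ ⟨y, -, rfl⟩
  exact ha.trForm_nonneg h y

/-- Hermite-type bound for the minimum of the trace form of a totally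
positive element. -/
theorem mu_le_hermite_bound
    (K : Type*) [Field K] [NumberField K] (n : ℕ)
    (hdeg : Module.finrank ℚ K = n) (htr : TotallyReal K)
    (a : K) (ha : TotPos a) :
    muMin a ≤
      2 / π * Real.Gamma (2 + (n : ℝ) / 2) ^ ((2 : ℝ) / (n : ℝ)) *
        |(NumberField.discr K : ℝ)| ^ ((1 : ℝ) / (n : ℝ)) *
        (Algebra.norm ℚ a : ℝ) ^ ((1 : ℝ) / (n : ℝ)) := by
  classical
  let : Fintype (K →+* ℝ) := @Fintype.ofFinite _ (finite_ringHom_real K)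
  have hn : Fintype.card (Module.Free.ChooseBasisIndex ℤ (𝓞 K)) = n := by
    rw [← Module.finrank_eq_card_basis (integralBasis K), hdeg]
  have hnorm : 0 < (Algebra.norm ℚ a : ℝ) := by
    rw [htr.norm_eq_prod]
    exact Finset.prod_pos fun φ _ ↦ ha φ
  rcases le_or_gt (muMin a) 0 with hμ | hμ
  · exact hμ.trans (by have := Gamma_pos_of_pos (by positivity : 0 < 2 + (n : ℝ) / 2); positivity)
  have hdet := det_gram_twistedEmbedding_integralBasis htr ha
  have hdiscr : (discr K : ℝ) ≠ 0 := by exact_mod_cast discr_ne_zero K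
  have hdiscr_nonneg : 0 ≤ (discr K : ℝ) := nonneg_of_mul_nonneg_right
    (hdet ▸ (Matrix.posSemidef_gram ℝ _).det_nonneg) hnorm
  have hbound := le_blichfeldt_bound (fun i ↦ twistedEmbedding a (integralBasis K i))
    (by rw [finrank_euclideanSpace, htr.card_ringHom_real, hn, hdeg])
    (by rw [hdet]; positivity) hμ (fun v hv hv0 ↦ ?_)
  · rwa [hn, hdet, mul_comm (Algebra.norm ℚ a : ℝ), Real.mul_rpow hdiscr_nonneg hnorm.le,
      ← mul_assoc, ← abs_of_nonneg hdiscr_nonneg] at hbound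
  · have hspan : Submodule.span ℤ (Set.range fun i ↦ twistedEmbedding a (integralBasis K i)) =
        (Submodule.span ℤ (Set.range (integralBasis K))).map
          (twistedEmbedding a).toIntLinearMap := by
      rw [Submodule.map_span, ← Set.range_comp]
      rfl
    rw [hspan] at hv
    obtain ⟨x, hx, rfl⟩ := hv
    obtain ⟨y, rfl⟩ := (mem_span_integralBasis K).mp hx
    have hy : y ≠ 0 := by
      rintro rfl
      simp at hv0
    exact (ha.muMin_le htr hy).trans_eq (norm_twistedEmbedding_sq htr ha _).symm
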